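/- Limits of the normalized ergodic capacity r₀(γ) = C̄(γ)/ln(1+γ), where C̄(γ) = e^{1/γ} ∫_{1/γ}^∞ t^{−1} e^{−t} dt: both lim_{γ → ∞} ( e^{1/γ} ∫_{1/γ}^∞ t^{−1} e^{−t} dt ) / ln(1+γ) = 1 and lim_{γ → 0⁺} ( e^{1/γ} ∫_{1/γ}^∞ t^{−1} e^{−t} dt ) / ln(1+γ) = 1. -/

import Mathlib

open MeasureTheory Real Set Filter

lemma integrableOn_inv_mul_exp_neg {x : ℝ} (hx : 0 < x) :
    IntegrableOn (fun t : ℝ => t⁻¹ * Real.exp (-t)) (Set.Ioi x) := by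
  refine Integrable.mono' ((integrableOn_exp_neg_Ioi x).const_mul x⁻¹) (by fun_prop) ?_
  refine (ae_restrict_iff' measurableSet_Ioi).2 (Eventually.of_forall fun t ht => ?_)
  have hxt : x < t := ht
  have ht0 : 0 < t := hx.trans hxt
  rw [Real.norm_of_nonneg (by positivity)]
  gcongr

lemma exp_mul_integral_le_log {x : ℝ} (hx : 0 < x) :
    Real.exp x * ∫ t in Set.Ioi x, t⁻¹ * Real.exp (-t) ≤ Real.log (1 + x⁻¹) := by
  have hderiv : ∀ t ∈ Set.Ici x, HasDerivAt (fun t => -(Real.exp (-t) * Real.log (1 + t⁻¹)))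
      (Real.exp (-t) * (Real.log (1 + t⁻¹) + t⁻¹ - (1 + t)⁻¹)) t := by
    intro t ht
    have ht0 : 0 < t := hx.trans_le ht
    have hlog := ((hasDerivAt_inv ht0.ne').const_add 1).log (by positivity)
    refine ((hasDerivAt_neg t).exp.mul hlog).neg.congr_deriv ?_
    field_simp
    ring
  have hle : ∀ t ∈ Set.Ioi x, t⁻¹ * Real.exp (-t) ≤
      Real.exp (-t) * (Real.log (1 + t⁻¹) + t⁻¹ - (1 + t)⁻¹) := by
    intro t ht
    have ht0 : 0 < t := hx.trans ht
    have h := Real.one_sub_inv_le_log_of_pos (show 0 < 1 + t⁻¹ by positivity)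
    have h' : 1 - (1 + t⁻¹)⁻¹ = (1 + t)⁻¹ := by field_simp; ring
    rw [mul_comm]
    gcongr
    linarith
  have hlim : Tendsto (fun t => -(Real.exp (-t) * Real.log (1 + t⁻¹))) atTop (nhds 0) := by
    have h1 : Tendsto (fun t : ℝ => Real.log (1 + t⁻¹)) atTop (nhds (Real.log (1 + 0))) :=
      (tendsto_inv_atTop_zero.const_add 1).log (by norm_num)
    simpa using (Real.tendsto_exp_neg_atTop_nhds_zero.mul h1).neg
  have hnonneg : ∀ t ∈ Set.Ioi x,
      0 ≤ Real.exp (-t) * (Real.log (1 + t⁻¹) + t⁻¹ - (1 + t)⁻¹) := by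
    intro t ht
    have ht0 : 0 < t := hx.trans ht
    exact le_trans (by positivity) (hle t ht)
  have hmono := setIntegral_mono_on (integrableOn_inv_mul_exp_neg hx)
    (integrableOn_Ioi_deriv_of_nonneg' hderiv hnonneg hlim) measurableSet_Ioi hle
  rw [integral_Ioi_of_hasDerivAt_of_nonneg' hderiv hnonneg hlim] at hmono
  calc _ ≤ Real.exp x * (0 - -(Real.exp (-x) * Real.log (1 + x⁻¹))) := by gcongr
    _ = _ := by rw [zero_sub, neg_neg, ← mul_assoc, ← Real.exp_add]; simp

lemma inv_one_add_le_exp_mul_integral {x : ℝ} (hx : 0 < x) :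
    (1 + x)⁻¹ ≤ Real.exp x * ∫ t in Set.Ioi x, t⁻¹ * Real.exp (-t) := by
  have hderiv : ∀ t ∈ Set.Ici x, HasDerivAt (fun t => -(Real.exp (-t) * (1 + t)⁻¹))
      (Real.exp (-t) * ((1 + t)⁻¹ + ((1 + t) ^ 2)⁻¹)) t := by
    intro t ht
    have ht0 : 0 < t := hx.trans_le ht
    have hinv := ((hasDerivAt_id t).const_add 1).inv (show 1 + id t ≠ 0 by simp; positivity)
    refine ((hasDerivAt_neg t).exp.mul hinv).neg.congr_deriv ?_
    simp only [id, Pi.inv_apply]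
    field_simp
    ring
  have hle : ∀ t ∈ Set.Ioi x,
      Real.exp (-t) * ((1 + t)⁻¹ + ((1 + t) ^ 2)⁻¹) ≤ t⁻¹ * Real.exp (-t) := by
    intro t ht
    have ht0 : 0 < t := hx.trans ht
    rw [mul_comm]
    gcongr
    field_simp
    nlinarith
  have hlim : Tendsto (fun t : ℝ => -(Real.exp (-t) * (1 + t)⁻¹)) atTop (nhds 0) := by
    have h1 : Tendsto (fun t : ℝ => (1 + t)⁻¹) atTop (nhds 0) :=
      (tendsto_atTop_add_const_left _ 1 tendsto_id).inv_tendsto_atTop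
    simpa using (Real.tendsto_exp_neg_atTop_nhds_zero.mul h1).neg
  have hnonneg : ∀ t ∈ Set.Ioi x,
      0 ≤ Real.exp (-t) * ((1 + t)⁻¹ + ((1 + t) ^ 2)⁻¹) := by
    intro t ht
    have ht0 : 0 < t := hx.trans ht
    positivity
  have hmono := setIntegral_mono_on (integrableOn_Ioi_deriv_of_nonneg' hderiv hnonneg hlim)
    (integrableOn_inv_mul_exp_neg hx) measurableSet_Ioi hle
  rw [integral_Ioi_of_hasDerivAt_of_nonneg' hderiv hnonneg hlim] at hmono
  calc _ = Real.exp x * (0 - -(Real.exp (-x) * (1 + x)⁻¹)) := by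
        rw [zero_sub, neg_neg, ← mul_assoc, ← Real.exp_add]; simp
    _ ≤ _ := by gcongr

lemma neg_log_sub_one_le_exp_mul_integral {x : ℝ} (hx : 0 < x) (hx1 : x ≤ 1) :
    -Real.log x - 1 ≤ Real.exp x * ∫ t in Set.Ioi x, t⁻¹ * Real.exp (-t) := by
  have hint := integrableOn_inv_mul_exp_neg hx
  have hnonneg : ∀ t ∈ Set.Ioi x, 0 ≤ t⁻¹ * Real.exp (-t) := by
    intro t ht
    have ht0 : 0 < t := hx.trans ht
    positivity
  have hsub : ∫ t in Set.Ioc x 1, t⁻¹ * Real.exp (-t) ≤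
      ∫ t in Set.Ioi x, t⁻¹ * Real.exp (-t) :=
    setIntegral_mono_set hint ((ae_restrict_iff' measurableSet_Ioi).2
      (Eventually.of_forall hnonneg)) Ioc_subset_Ioi_self.eventuallyLE
  have hinv : IntervalIntegrable (fun t : ℝ => t⁻¹) volume x 1 := by
    refine intervalIntegral.intervalIntegrable_inv (fun t ht => ?_) continuousOn_id
    rw [Set.uIcc_of_le hx1] at ht
    exact (hx.trans_le ht.1).ne'
  have hone : IntervalIntegrable (fun _ : ℝ => (1 : ℝ)) volume x 1 :=
    intervalIntegrable_const
  have hmono : ∫ t in x..1, (t⁻¹ - 1) ≤ ∫ t in x..1, t⁻¹ * Real.exp (-t) := by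
    refine intervalIntegral.integral_mono_on hx1 (hinv.sub hone)
      ((intervalIntegrable_iff_integrableOn_Ioc_of_le hx1).2
        (hint.mono_set Ioc_subset_Ioi_self)) fun t ht => ?_
    have ht0 : 0 < t := hx.trans_le ht.1
    calc t⁻¹ - 1 = t⁻¹ * (-t + 1) := by field_simp; ring
      _ ≤ _ := by gcongr; exact Real.add_one_le_exp _
  rw [intervalIntegral.integral_sub hinv hone, integral_inv_of_pos hx one_pos,
    intervalIntegral.integral_const, intervalIntegral.integral_of_le hx1, one_div,
    Real.log_inv, smul_eq_mul, mul_one] at hmono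
  have h0 : 0 ≤ ∫ t in Set.Ioi x, t⁻¹ * Real.exp (-t) :=
    setIntegral_nonneg measurableSet_Ioi hnonneg
  have h1 := mul_le_mul_of_nonneg_right (Real.one_le_exp hx.le) h0
  linarith

/-- Limits of the normalized ergodic capacity `r₀(γ) = C̄(γ)/ln(1+γ)` with
`C̄(γ) = e^{1/γ} ∫_{1/γ}^∞ t⁻¹ e^{−t} dt`: it tends to `1` both as `γ → ∞` and as `γ → 0⁺`. -/
theorem stmt_16 :
    Tendsto (fun γ : ℝ =>
        (Real.exp (1 / γ) * ∫ t in Set.Ioi (1 / γ), t⁻¹ * Real.exp (-t)) / Real.log (1 + γ))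
      atTop (nhds 1) ∧
    Tendsto (fun γ : ℝ =>
        (Real.exp (1 / γ) * ∫ t in Set.Ioi (1 / γ), t⁻¹ * Real.exp (-t)) / Real.log (1 + γ))
      (nhdsWithin 0 (Set.Ioi 0)) (nhds 1) := by
  have hupper : ∀ γ : ℝ, 0 < γ →
      (Real.exp (1 / γ) * ∫ t in Set.Ioi (1 / γ), t⁻¹ * Real.exp (-t)) / Real.log (1 + γ) ≤ 1 := by
    intro γ hγ
    have h := exp_mul_integral_le_log (one_div_pos.2 hγ)
    rw [one_div, inv_inv] at h
    rw [one_div]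
    exact div_le_one_of_le₀ h (Real.log_nonneg (by linarith))
  constructor
  · have hlog : Tendsto (fun γ : ℝ => Real.log (1 + γ)) atTop atTop :=
      Real.tendsto_log_atTop.comp (tendsto_atTop_add_const_left _ 1 tendsto_id)
    have hlow : Tendsto (fun γ : ℝ => 1 - (Real.log 2 + 1) / Real.log (1 + γ)) atTop (nhds 1) := by
      simpa using (hlog.const_div_atTop (Real.log 2 + 1)).const_sub 1
    refine tendsto_of_tendsto_of_tendsto_of_le_of_le' hlow tendsto_const_nhds ?_ ?_
    · filter_upwards [eventually_ge_atTop 1] with γ hγ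
      have hγ0 : 0 < γ := one_pos.trans_le hγ
      have hpos : 0 < Real.log (1 + γ) := Real.log_pos (by linarith)
      have h := neg_log_sub_one_le_exp_mul_integral (one_div_pos.2 hγ0)
        ((div_le_one hγ0).2 hγ)
      have h2 : Real.log (1 + γ) ≤ Real.log 2 + Real.log γ := by
        rw [← Real.log_mul two_ne_zero hγ0.ne']
        exact Real.log_le_log (by linarith) (by linarith)
      rw [le_div_iff₀ hpos, sub_mul, div_mul_cancel₀ _ hpos.ne']
      have h3 : Real.log (1 / γ) = -Real.log γ := by rw [one_div, Real.log_inv]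
      linarith
    · filter_upwards [eventually_gt_atTop 0] with γ hγ using hupper γ hγ
  · have hlow : Tendsto (fun γ : ℝ => (1 + γ)⁻¹) (nhdsWithin 0 (Set.Ioi 0)) (nhds 1) := by
      have h : ContinuousAt (fun γ : ℝ => (1 + γ)⁻¹) 0 :=
        (continuousAt_const.add continuousAt_id).inv₀ (by simp)
      simpa using h.tendsto.mono_left nhdsWithin_le_nhds
    refine tendsto_of_tendsto_of_tendsto_of_le_of_le' hlow tendsto_const_nhds ?_ ?_
    · filter_upwards [self_mem_nhdsWithin] with γ hγ
      have hγ0 : 0 < γ := hγ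
      have hpos : 0 < Real.log (1 + γ) := Real.log_pos (by linarith)
      rw [le_div_iff₀ hpos]
      refine le_trans ?_ (inv_one_add_le_exp_mul_integral (one_div_pos.2 hγ0))
      calc (1 + γ)⁻¹ * Real.log (1 + γ) ≤ (1 + γ)⁻¹ * γ := by
            gcongr
            linarith [Real.log_le_sub_one_of_pos (show 0 < 1 + γ by linarith)]
        _ = (1 + 1 / γ)⁻¹ := by field_simp; ring
    · filter_upwards [self_mem_nhdsWithin] with γ hγ using hupper γ hγ
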